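/- Let A, B be probability measures and suppose d_TV(A,B) ≤ 1 - λ with λ > 0, and d_TV(A,C) ≥ 1 - ε for a third probability measure C, where A, B, C are nondegenerate Gaussians on R^d. Then d_TV(B,C) ≥ 1 - ε^{c(λ)} for some exponent c(λ) > 0 depending only on λ (and not on the dimension d), provided ε is sufficiently small in terms of λ. -/

import Mathlib

open MeasureTheory Matrix

/-- Total variation distance between two measures. -/
noncomputable def tvDist {α : Type*} [MeasurableSpace α] (μ ν : Measure α) : ℝ :=
  ⨆ s : {s : Set α // MeasurableSet s}, |(μ s).toReal - (ν s).toReal|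

/-- Density of the Gaussian `N(μ, S)` on `ℝ^d`. -/
noncomputable def gaussianPdf (d : ℕ) (μ : Fin d → ℝ) (S : Matrix (Fin d) (Fin d) ℝ)
    (x : Fin d → ℝ) : ℝ :=
  (Real.sqrt ((2 * Real.pi) ^ d * S.det))⁻¹ *
    Real.exp (-((x - μ) ⬝ᵥ S⁻¹ *ᵥ (x - μ)) / 2)

/-- The Gaussian measure `N(μ, S)` on `ℝ^d`, defined by its density. -/
noncomputable def gaussianMeasure (d : ℕ) (μ : Fin d → ℝ)
    (S : Matrix (Fin d) (Fin d) ℝ) : Measure (Fin d → ℝ) :=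
  volume.withDensity fun x => ENNReal.ofReal (gaussianPdf d μ S x)


theorem exists_orthogonal_diagonalization {d : ℕ} {P : Matrix (Fin d) (Fin d) ℝ}
    (hP : P.PosDef) :
    ∃ (V : Matrix (Fin d) (Fin d) ℝ) (p : Fin d → ℝ),
      Vᵀ * V = 1 ∧ (∀ i, 0 < p i) ∧ Vᵀ * P * V = diagonal p := by
  refine ⟨hP.1.eigenvectorUnitary, hP.1.eigenvalues, ?_, hP.eigenvalues_pos, ?_⟩
  · exact Unitary.coe_star_mul_self hP.1.eigenvectorUnitary
  · simpa [Unitary.conjStarAlgAut_star_apply, star_eq_conjTranspose,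
      conjTranspose_eq_transpose_of_trivial] using hP.1.conjStarAlgAut_star_eigenvectorUnitary

theorem exists_simultaneous_diagonalization {d : ℕ} {P Q : Matrix (Fin d) (Fin d) ℝ}
    (hP : P.PosDef) (hQ : Q.PosDef) :
    ∃ (L : Matrix (Fin d) (Fin d) ℝ) (τ : Fin d → ℝ), IsUnit L.det ∧ (∀ i, 0 < τ i) ∧
      Lᵀ * P * L = 1 ∧ Lᵀ * Q * L = diagonal τ := by
  obtain ⟨V, p, hV, hp, hPV⟩ := exists_orthogonal_diagonalization hP
  set D : Matrix (Fin d) (Fin d) ℝ := diagonal fun i => (√(p i))⁻¹ with hD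
  have hM : (V * D)ᵀ * P * (V * D) = 1 := by
    have : (V * D)ᵀ * P * (V * D) = D * (Vᵀ * P * V) * D := by
      simp [hD, Matrix.transpose_mul, Matrix.mul_assoc]
    rw [this, hPV, hD, diagonal_mul_diagonal, diagonal_mul_diagonal, ← diagonal_one]
    congr 1
    ext i
    have h := Real.sqrt_pos.2 (hp i)
    have h2 := Real.mul_self_sqrt (hp i).le
    field_simp
    nlinarith
  have hMdet : IsUnit (V * D).det := by
    have := congrArg det hM
    rw [det_mul, det_mul, det_one] at this
    exact IsUnit.of_mul_eq_one_right _ this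
  have hN : ((V * D)ᵀ * Q * (V * D)).PosDef := by
    have := hQ.conjTranspose_mul_mul_same (B := V * D)
      (Matrix.mulVec_injective_of_isUnit ((Matrix.isUnit_iff_isUnit_det _).2 hMdet))
    simpa using this
  set M := V * D
  obtain ⟨W, q, hW, hq, hQW⟩ := exists_orthogonal_diagonalization hN
  refine ⟨M * W, q, ?_, hq, ?_, ?_⟩
  · rw [det_mul]
    refine hMdet.mul ?_
    have := congrArg det hW
    rw [det_mul, det_one] at this
    exact IsUnit.of_mul_eq_one_right _ this
  · calc (M * W)ᵀ * P * (M * W) = Wᵀ * (Mᵀ * P * M) * W := by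
          simp [Matrix.transpose_mul, Matrix.mul_assoc]
      _ = 1 := by rw [hM, Matrix.mul_one, hW]
  · rw [← hQW]
    simp [Matrix.transpose_mul, Matrix.mul_assoc]

/-- Density of the one-dimensional Gaussian with mean `m` and variance `τ⁻¹`. -/
noncomputable def gaussianPrecPdf (τ m y : ℝ) : ℝ :=
  √(τ / (2 * Real.pi)) * Real.exp (-(τ * (y - m) ^ 2) / 2)

theorem gaussianPrecPdf_pos {τ : ℝ} (hτ : 0 < τ) (m y : ℝ) : 0 < gaussianPrecPdf τ m y := by
  unfold gaussianPrecPdf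
  positivity

theorem gaussianPdf_pos {d : ℕ} {S : Matrix (Fin d) (Fin d) ℝ} (hS : S.PosDef)
    (μ x : Fin d → ℝ) : 0 < gaussianPdf d μ S x := by
  have := hS.det_pos
  unfold gaussianPdf
  positivity

theorem continuous_gaussianPdf (d : ℕ) (μ : Fin d → ℝ) (S : Matrix (Fin d) (Fin d) ℝ) :
    Continuous (gaussianPdf d μ S) := by
  unfold gaussianPdf
  fun_prop

theorem abs_det_mul_gaussianPdf {d : ℕ} {S L : Matrix (Fin d) (Fin d) ℝ} {τ : Fin d → ℝ}
    (hS : S.PosDef) (hτ : ∀ i, 0 < τ i) (h : Lᵀ * S⁻¹ * L = diagonal τ) (μ m y : Fin d → ℝ) :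
    |L.det| * gaussianPdf d (μ + L *ᵥ m) S (μ + L *ᵥ y) =
      ∏ i, gaussianPrecPdf (τ i) (m i) (y i) := by
  have hquad : (μ + L *ᵥ y - (μ + L *ᵥ m)) ⬝ᵥ S⁻¹ *ᵥ (μ + L *ᵥ y - (μ + L *ᵥ m)) =
      ∑ i, τ i * (y i - m i) ^ 2 := by
    have : μ + L *ᵥ y - (μ + L *ᵥ m) = L *ᵥ (y - m) := by
      rw [mulVec_sub]; abel
    rw [this, dotProduct_comm, ← Matrix.dotProduct_transpose_mulVec, mulVec_mulVec, mulVec_mulVec,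
      h]
    simp [dotProduct, mulVec_diagonal]
    refine Finset.sum_congr rfl fun i _ => by ring
  have hdet : |L.det| = √(S.det * ∏ i, τ i) := by
    have h1 := congrArg det h
    rw [det_mul, det_mul, det_transpose, det_diagonal, det_nonsing_inv, Ring.inverse_eq_inv'] at h1
    rw [← h1, ← Real.sqrt_sq_eq_abs]
    congr 1
    have := hS.det_pos
    field_simp
  unfold gaussianPdf gaussianPrecPdf
  rw [hquad, Finset.prod_mul_distrib, ← Real.exp_sum, ← mul_assoc]
  congr 1
  · rw [hdet, ← Real.sqrt_prod _ fun i _ => by have := hτ i; positivity, ← Real.sqrt_inv,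
      ← Real.sqrt_mul (mul_nonneg hS.det_pos.le (Finset.prod_nonneg fun i _ => (hτ i).le))]
    congr 1
    rw [Finset.prod_div_distrib]
    have := hS.det_pos
    simp
    field_simp
  · congr 1
    rw [← Finset.sum_neg_distrib, Finset.sum_div]

theorem integral_eq_integral_comp_affine {d : ℕ} {L : Matrix (Fin d) (Fin d) ℝ}
    (hL : IsUnit L.det) (μ : Fin d → ℝ) {f g : (Fin d → ℝ) → ℝ} (hf : Continuous f)
    (hfg : ∀ y, |L.det| * f (μ + L *ᵥ y) = g y) (hg : Integrable g) :
    Integrable f ∧ ∫ x, f x = ∫ y, g y := by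
  have hdet : 0 < |L.det| := abs_pos.2 hL.ne_zero
  have hT : Continuous fun y : Fin d → ℝ => μ + L *ᵥ y := by fun_prop
  have hmap : Measure.map (fun y : Fin d → ℝ => μ + L *ᵥ y) volume =
      ENNReal.ofReal |(L.det)⁻¹| • volume := by
    have h1 := Real.map_matrix_volume_pi_eq_smul_volume_pi hL.ne_zero
    have h2 : (fun y : Fin d → ℝ => μ + L *ᵥ y) = (fun y => μ + y) ∘ toLin' L := by
      ext; simp
    rw [h2, ← Measure.map_map (by fun_prop) (LinearMap.continuous_of_finiteDimensional _).measurable, h1,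
      Measure.map_smul, map_add_left_eq_self]
  have hg' : (fun y => f (μ + L *ᵥ y)) = fun y => |L.det|⁻¹ * g y := by
    ext y
    rw [← hfg]
    field_simp
  constructor
  · have : Integrable f (Measure.map (fun y : Fin d → ℝ => μ + L *ᵥ y) volume) := by
      rw [integrable_map_measure hf.aestronglyMeasurable hT.aemeasurable]
      change Integrable (fun y => f (μ + L *ᵥ y))
      rw [hg']
      exact hg.const_mul _
    rw [hmap, integrable_smul_measure] at this
    · exact this
    · simpa using hL.ne_zero
    · exact ENNReal.ofReal_ne_top
  · have := integral_map (μ := volume) hT.aemeasurable (f := f) hf.aestronglyMeasurable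
    rw [hmap, integral_smul_measure, hg', integral_const_mul, abs_inv,
      ENNReal.toReal_ofReal (by positivity), smul_eq_mul] at this
    exact mul_left_cancel₀ (by positivity) this

theorem integral_gaussianPrecPdf_rpow {τ m θ : ℝ} (hτ : 0 < τ) (hq : 0 < 1 - θ + θ * τ) :
    Integrable (fun y => gaussianPrecPdf 1 0 y ^ (1 - θ) * gaussianPrecPdf τ m y ^ θ) ∧
    ∫ y, gaussianPrecPdf 1 0 y ^ (1 - θ) * gaussianPrecPdf τ m y ^ θ =
      Real.exp (θ / 2 * Real.log τ - Real.log (1 - θ + θ * τ) / 2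
        - θ * (1 - θ) * τ * m ^ 2 / (2 * (1 - θ + θ * τ))) := by
  set q := 1 - θ + θ * τ with hqdef
  have hpi := Real.pi_pos
  have key : ∀ y, gaussianPrecPdf 1 0 y ^ (1 - θ) * gaussianPrecPdf τ m y ^ θ =
      Real.exp (θ / 2 * Real.log τ - Real.log (2 * Real.pi) / 2
        - θ * (1 - θ) * τ * m ^ 2 / (2 * q)) * Real.exp (-(q / 2) * (y - θ * τ * m / q) ^ 2) := by
    intro y
    rw [Real.rpow_def_of_pos (gaussianPrecPdf_pos one_pos _ _),
      Real.rpow_def_of_pos (gaussianPrecPdf_pos hτ _ _), ← Real.exp_add, ← Real.exp_add]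
    congr 1
    unfold gaussianPrecPdf
    rw [Real.log_mul (by positivity) (by positivity), Real.log_mul (by positivity) (by positivity),
      Real.log_exp, Real.log_exp, Real.log_sqrt (by positivity), Real.log_sqrt (by positivity),
      Real.log_div (by positivity) (by positivity), Real.log_div (by positivity) (by positivity),
      Real.log_one]
    have : τ * θ = q - 1 + θ := by rw [hqdef]; ring
    field_simp
    rw [hqdef]
    ring
  have hI := integrable_exp_neg_mul_sq (half_pos hq)
  simp_rw [key]
  refine ⟨(hI.comp_sub_right _).const_mul _, ?_⟩
  rw [integral_const_mul, integral_sub_right_eq_self (fun y => Real.exp (-(q / 2) * y ^ 2)),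
    integral_gaussian, ← Real.exp_log (Real.sqrt_pos.2 (by positivity : 0 < Real.pi / (q / 2))),
    ← Real.exp_add, Real.log_sqrt (by positivity)]
  congr 1
  have : Real.pi / (q / 2) = 2 * Real.pi / q := by field_simp
  rw [this, Real.log_div (by positivity) hq.ne']
  ring

/-- The logarithm of `∫ α ^ (1 - θ) * β ^ θ` for `α = N(0, 1)` and `β = N(m, τ⁻¹)`. -/
noncomputable def logAffinity (θ τ m : ℝ) : ℝ :=
  θ / 2 * Real.log τ - Real.log (1 - θ + θ * τ) / 2
    - θ * (1 - θ) * τ * m ^ 2 / (2 * (1 - θ + θ * τ))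

theorem integral_gaussianPdf_rpow {d : ℕ} {μA μB : Fin d → ℝ}
    {SA SB L : Matrix (Fin d) (Fin d) ℝ} (hA : SA.PosDef) (hB : SB.PosDef) {τ : Fin d → ℝ}
    (hL : IsUnit L.det) (hτ : ∀ i, 0 < τ i) (hLA : Lᵀ * SA⁻¹ * L = 1)
    (hLB : Lᵀ * SB⁻¹ * L = diagonal τ) {θ : ℝ} (hq : ∀ i, 0 < 1 - θ + θ * τ i) :
    Integrable (fun x => gaussianPdf d μA SA x ^ (1 - θ) * gaussianPdf d μB SB x ^ θ) ∧
    ∫ x, gaussianPdf d μA SA x ^ (1 - θ) * gaussianPdf d μB SB x ^ θ =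
      Real.exp (∑ i, logAffinity θ (τ i) ((L⁻¹ *ᵥ (μB - μA)) i)) := by
  set m := L⁻¹ *ᵥ (μB - μA) with hm
  have hdet : 0 < |L.det| := abs_pos.2 hL.ne_zero
  have hμB : μB = μA + L *ᵥ m := by
    rw [hm, mulVec_mulVec, mul_nonsing_inv _ hL, one_mulVec]; abel
  have h1 := fun i => integral_gaussianPrecPdf_rpow (m := m i) (hτ i) (hq i)
  have hint : Integrable (fun y : Fin d → ℝ => ∏ i, (gaussianPrecPdf 1 0 (y i) ^ (1 - θ) *
      gaussianPrecPdf (τ i) (m i) (y i) ^ θ)) :=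
    Integrable.fintype_prod fun i => (h1 i).1
  have hA' : ∀ y, |L.det| * gaussianPdf d μA SA (μA + L *ᵥ y) =
      ∏ i, gaussianPrecPdf 1 0 (y i) := fun y => by
    simpa using abs_det_mul_gaussianPdf hA (τ := 1) (fun _ => one_pos)
      (by rw [hLA]; exact diagonal_one.symm) μA 0 y
  have hB' : ∀ y, |L.det| * gaussianPdf d μB SB (μA + L *ᵥ y) =
      ∏ i, gaussianPrecPdf (τ i) (m i) (y i) := fun y => by
    rw [hμB]
    exact abs_det_mul_gaussianPdf hB hτ hLB μA m y
  have key := integral_eq_integral_comp_affine hL μA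
    (f := fun x => gaussianPdf d μA SA x ^ (1 - θ) * gaussianPdf d μB SB x ^ θ) ?_ ?_ hint
  · refine ⟨key.1, key.2.trans ?_⟩
    rw [integral_fintype_prod_volume_eq_prod (fun i y => gaussianPrecPdf 1 0 y ^ (1 - θ) *
      gaussianPrecPdf (τ i) (m i) y ^ θ), Real.exp_sum]
    exact Finset.prod_congr rfl fun i _ => (h1 i).2
  · exact ((continuous_gaussianPdf _ _ _).rpow_const fun x => .inl (gaussianPdf_pos hA _ _).ne').mul
      ((continuous_gaussianPdf _ _ _).rpow_const fun x => .inl (gaussianPdf_pos hB _ _).ne')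
  · intro y
    rw [Finset.prod_mul_distrib,
      Real.finsetProd_rpow _ _ fun i _ => (gaussianPrecPdf_pos one_pos _ _).le,
      Real.finsetProd_rpow _ _ fun i _ => (gaussianPrecPdf_pos (hτ i) _ _).le, ← hA', ← hB',
      Real.mul_rpow hdet.le (gaussianPdf_pos hA _ _).le,
      Real.mul_rpow hdet.le (gaussianPdf_pos hB _ _).le]
    have : |L.det| = |L.det| ^ (1 - θ) * |L.det| ^ θ := by
      rw [← Real.rpow_add hdet]; simp
    nth_rewrite 1 [this]
    ring

theorem integral_gaussianPdf {d : ℕ} {S : Matrix (Fin d) (Fin d) ℝ} (hS : S.PosDef)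
    (μ : Fin d → ℝ) :
    Integrable (gaussianPdf d μ S) ∧ ∫ x, gaussianPdf d μ S x = 1 := by
  obtain ⟨L, τ, hL, hτ, h1, h2⟩ := exists_simultaneous_diagonalization hS.inv hS.inv
  simpa [logAffinity] using integral_gaussianPdf_rpow (μA := μ) (μB := μ) (θ := 0)
    hS hS hL hτ h1 h2 (by simp)

theorem withDensity_ofReal_toReal {α : Type*} [MeasurableSpace α] {ν : Measure α} {f : α → ℝ}
    (hf : Integrable f ν) (hf0 : 0 ≤ f) {s : Set α} (hs : MeasurableSet s) :
    ((ν.withDensity fun x => ENNReal.ofReal (f x)) s).toReal = ∫ x in s, f x ∂ν := by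
  rw [withDensity_apply _ hs, ← ofReal_integral_eq_lintegral_ofReal hf.integrableOn
    (Filter.Eventually.of_forall hf0), ENNReal.toReal_ofReal (integral_nonneg hf0)]

theorem tvDist_withDensity {α : Type*} [MeasurableSpace α] {ν : Measure α} {f g : α → ℝ}
    (hfm : Measurable f) (hgm : Measurable g)
    (hf : Integrable f ν) (hg : Integrable g ν) (hf0 : 0 ≤ f) (hg0 : 0 ≤ g)
    (hf1 : ∫ x, f x ∂ν = 1) (hg1 : ∫ x, g x ∂ν = 1) :
    tvDist (ν.withDensity fun x => ENNReal.ofReal (f x))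
      (ν.withDensity fun x => ENNReal.ofReal (g x)) = 1 - ∫ x, min (f x) (g x) ∂ν := by
  have hmin : Integrable (fun x => min (f x) (g x)) ν := hf.inf hg
  have aux : ∀ {f g : α → ℝ}, Integrable f ν → Integrable g ν → ∫ x, f x ∂ν = 1 →
      ∀ s, MeasurableSet s → Integrable (fun x => min (f x) (g x)) ν →
      (∫ x in s, f x ∂ν) - (∫ x in s, g x ∂ν) ≤ 1 - ∫ x, min (f x) (g x) ∂ν := by
    intro f g hf hg hf1 s hs hmin
    rw [← hf1, ← integral_add_compl hs hf, ← integral_add_compl hs hmin]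
    have h1 : ∫ x in s, min (f x) (g x) ∂ν ≤ ∫ x in s, g x ∂ν :=
      integral_mono hmin.integrableOn hg.integrableOn fun x => min_le_right _ _
    have h2 : ∫ x in sᶜ, min (f x) (g x) ∂ν ≤ ∫ x in sᶜ, f x ∂ν :=
      integral_mono hmin.integrableOn hf.integrableOn fun x => min_le_left _ _
    linarith
  have bound : ∀ s : {s : Set α // MeasurableSet s},
      |((ν.withDensity fun x => ENNReal.ofReal (f x)) s).toReal -
        ((ν.withDensity fun x => ENNReal.ofReal (g x)) s).toReal| ≤
      1 - ∫ x, min (f x) (g x) ∂ν := by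
    rintro ⟨s, hs⟩
    rw [withDensity_ofReal_toReal hf hf0 hs, withDensity_ofReal_toReal hg hg0 hs, abs_le]
    have h1 := aux hf hg hf1 s hs hmin
    have h2 := aux hg hf hg1 s hs (by simpa only [min_comm] using hmin)
    simp only [min_comm (g _)] at h2
    constructor <;> linarith
  unfold tvDist
  have : Nonempty {s : Set α // MeasurableSet s} := ⟨⟨∅, .empty⟩⟩
  refine le_antisymm (ciSup_le bound) ?_
  have hs : MeasurableSet {x | g x < f x} := measurableSet_lt hgm hfm
  refine le_trans ?_ (le_ciSup ⟨_, Set.forall_mem_range.2 bound⟩ ⟨_, hs⟩)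
  refine le_trans (le_of_eq ?_) (le_abs_self _)
  rw [withDensity_ofReal_toReal hf hf0 hs, withDensity_ofReal_toReal hg hg0 hs]
  have h1 : ∫ x in {x | g x < f x}, min (f x) (g x) ∂ν = ∫ x in {x | g x < f x}, g x ∂ν :=
    setIntegral_congr_fun hs fun x hx => min_eq_right (le_of_lt hx)
  have h2 : ∫ x in {x | g x < f x}ᶜ, min (f x) (g x) ∂ν = ∫ x in {x | g x < f x}ᶜ, f x ∂ν :=
    setIntegral_congr_fun hs.compl fun x hx => min_eq_left (not_lt.1 hx)
  rw [← hf1, ← integral_add_compl hs hf, ← integral_add_compl hs hmin, h1, h2]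
  ring

theorem tvDist_gaussianMeasure {d : ℕ} {S T : Matrix (Fin d) (Fin d) ℝ} (hS : S.PosDef)
    (hT : T.PosDef) (μ ν : Fin d → ℝ) :
    tvDist (gaussianMeasure d μ S) (gaussianMeasure d ν T) =
      1 - ∫ x, min (gaussianPdf d μ S x) (gaussianPdf d ν T x) :=
  tvDist_withDensity (continuous_gaussianPdf _ _ _).measurable
    (continuous_gaussianPdf _ _ _).measurable (integral_gaussianPdf hS μ).1
    (integral_gaussianPdf hT ν).1 (fun x => (gaussianPdf_pos hS _ x).le)
    (fun x => (gaussianPdf_pos hT _ x).le) (integral_gaussianPdf hS μ).2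
    (integral_gaussianPdf hT ν).2

theorem logAffinity_half {τ : ℝ} (hτ : 0 < τ) (m : ℝ) :
    logAffinity (1 / 2) τ m =
      -(Real.log (1 + (τ - 1) ^ 2 / (4 * τ)) / 4 + τ * m ^ 2 / (4 * (1 + τ))) := by
  have h : 1 + (τ - 1) ^ 2 / (4 * τ) = (1 - 1 / 2 + 1 / 2 * τ) ^ 2 / τ := by
    field_simp; ring
  have h2 : 1 - 1 / 2 + 1 / 2 * τ = (1 + τ) / 2 := by ring
  unfold logAffinity
  rw [h, Real.log_div (by positivity) hτ.ne', Real.log_pow, h2]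
  field_simp
  push_cast
  ring

theorem logAffinity_half_nonpos {τ : ℝ} (hτ : 0 < τ) (m : ℝ) :
    logAffinity (1 / 2) τ m ≤ 0 := by
  rw [logAffinity_half hτ]
  have : 0 ≤ Real.log (1 + (τ - 1) ^ 2 / (4 * τ)) :=
    Real.log_nonneg (le_add_of_nonneg_right (by positivity))
  have : 0 ≤ τ * m ^ 2 / (4 * (1 + τ)) := by positivity
  linarith

theorem logAffinity_one_add_le {τ m l : ℝ} (hτ : 0 < τ) (hl : 0 < l) (hl1 : l ≤ 1)
    (h : Real.log l ≤ logAffinity (1 / 2) τ m) :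
    0 < 1 - (1 + l ^ 4 / 8) + (1 + l ^ 4 / 8) * τ ∧
      logAffinity (1 + l ^ 4 / 8) τ m ≤ -5 * logAffinity (1 / 2) τ m := by
  rw [logAffinity_half hτ] at *
  set x := (τ - 1) ^ 2 / (4 * τ) with hx
  have hx0 : 0 ≤ x := by positivity
  have hl4 : 0 < l ^ 4 := by positivity
  have hl41 : l ^ 4 ≤ 1 := pow_le_one₀ hl.le hl1
  have hxl : (1 + x) * l ^ 4 ≤ 1 := by
    have h1 : 0 ≤ τ * m ^ 2 / (4 * (1 + τ)) := by positivity
    rw [← Real.log_nonpos_iff (by positivity), Real.log_mul (by positivity) (by positivity),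
      Real.log_pow]
    push_cast
    linarith
  have hτl : l ^ 4 ≤ 4 * τ := by
    have h1 : (1 + x) * (4 * τ) = (1 + τ) ^ 2 := by rw [hx]; field_simp; ring
    have h2 : 1 ≤ (1 + x) * (4 * τ) := by rw [h1]; nlinarith
    nlinarith
  set s := l ^ 4 / 8 with hs
  have hs0 : 0 < s := by positivity
  have hs1 : s ≤ 1 := by linarith
  set q := 1 - (1 + s) + (1 + s) * τ with hq
  have hqτ : τ / 2 ≤ q := by nlinarith
  have hq0 : 0 < q := by linarith
  refine ⟨hq0, ?_⟩
  have hlog : (1 + s) * Real.log τ - Real.log q ≤ 8 * s * (1 + s) * x := by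
    have h1 := Real.log_le_sub_one_of_pos hτ
    have h2 := Real.log_le_sub_one_of_pos (div_pos hτ hq0)
    rw [Real.log_div hτ.ne' hq0.ne'] at h2
    have h3 : s * (τ - 1) + (τ / q - 1) = s * (1 + s) * (τ - 1) ^ 2 / q := by
      field_simp
      rw [hq]; ring
    have h4 : s * (1 + s) * (τ - 1) ^ 2 / q ≤ s * (1 + s) * (τ - 1) ^ 2 / (τ / 2) := by
      gcongr
    have h5 : s * (1 + s) * (τ - 1) ^ 2 / (τ / 2) = 8 * s * (1 + s) * x := by
      rw [hx]; field_simp; ring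
    nlinarith
  have hmean : -((1 + s) * (1 - (1 + s)) * τ * m ^ 2 / (2 * q)) ≤ 2 * s * m ^ 2 := by
    have h1 : -((1 + s) * (1 - (1 + s)) * τ * m ^ 2 / (2 * q)) =
        (1 + s) * s * m ^ 2 * (τ / (2 * q)) := by field_simp; ring
    have h2 : τ / (2 * q) ≤ 1 := by rw [div_le_one (by positivity)]; linarith
    rw [h1]
    calc (1 + s) * s * m ^ 2 * (τ / (2 * q)) ≤ (1 + 1) * s * m ^ 2 * 1 := by gcongr
      _ = _ := by ring
  have hlow : l ^ 4 * x ≤ Real.log (1 + x) := by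
    have h1 := Real.one_sub_inv_le_log_of_pos (show 0 < 1 + x by positivity)
    have h2 : 1 - (1 + x)⁻¹ = x * (1 + x)⁻¹ := by field_simp; ring
    have h3 : l ^ 4 ≤ (1 + x)⁻¹ := by
      rw [← one_div, le_div_iff₀ (by positivity)]; linarith
    nlinarith
  have hlow2 : l ^ 4 * m ^ 2 / 20 ≤ τ * m ^ 2 / (4 * (1 + τ)) := by
    have h1 : l ^ 4 / 5 ≤ τ / (1 + τ) := by
      rw [div_le_div_iff₀ (by positivity) (by positivity)]; nlinarith
    have h2 : τ * m ^ 2 / (4 * (1 + τ)) = τ / (1 + τ) * m ^ 2 / 4 := by field_simp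
    rw [h2]
    nlinarith [sq_nonneg m]
  have hsx : s * (1 + s) * x ≤ s * 2 * x := by gcongr; linarith
  unfold logAffinity
  rw [← hq]
  have e1 : s * x = l ^ 4 * x / 8 := by rw [hs]; ring
  have e2 : s * m ^ 2 = l ^ 4 * m ^ 2 / 8 := by rw [hs]; ring
  have e3 : 0 ≤ l ^ 4 * x := by positivity
  linarith

theorem integral_gaussianPdf_rpow_le {d : ℕ} {μA μB : Fin d → ℝ}
    {SA SB : Matrix (Fin d) (Fin d) ℝ} (hA : SA.PosDef) (hB : SB.PosDef) {l : ℝ} (hl : 0 < l)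
    (hl1 : l ≤ 1) (h : l ≤ ∫ x, min (gaussianPdf d μA SA x) (gaussianPdf d μB SB x)) :
    Integrable (fun x => gaussianPdf d μA SA x ^ (-(l ^ 4 / 8)) *
      gaussianPdf d μB SB x ^ (1 + l ^ 4 / 8)) ∧
    ∫ x, gaussianPdf d μA SA x ^ (-(l ^ 4 / 8)) * gaussianPdf d μB SB x ^ (1 + l ^ 4 / 8) ≤
      (l ^ 5)⁻¹ := by
  obtain ⟨L, τ, hL, hτ, h1, h2⟩ := exists_simultaneous_diagonalization hA.inv hB.inv
  set m := L⁻¹ *ᵥ (μB - μA)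
  have hhalf := integral_gaussianPdf_rpow (μA := μA) (μB := μB) (θ := 1 / 2)
    hA hB hL hτ h1 h2 (fun i => by linarith [hτ i])
  have hsum : Real.log l ≤ ∑ i, logAffinity (1 / 2) (τ i) (m i) := by
    rw [Real.log_le_iff_le_exp hl, ← hhalf.2]
    refine h.trans (integral_mono
      ((integral_gaussianPdf hA μA).1.inf (integral_gaussianPdf hB μB).1) hhalf.1 fun x => ?_)
    have ha := gaussianPdf_pos hA μA x
    have hb := gaussianPdf_pos hB μB x
    have hm : 0 < min (gaussianPdf d μA SA x) (gaussianPdf d μB SB x) := lt_min ha hb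
    calc min (gaussianPdf d μA SA x) (gaussianPdf d μB SB x)
        = min (gaussianPdf d μA SA x) (gaussianPdf d μB SB x) ^ (1 - 1 / 2 : ℝ) *
          min (gaussianPdf d μA SA x) (gaussianPdf d μB SB x) ^ (1 / 2 : ℝ) := by
          rw [← Real.rpow_add hm]; simp
      _ ≤ _ := by
          gcongr
          · exact min_le_left _ _
          · exact min_le_right _ _
  have hi : ∀ i, Real.log l ≤ logAffinity (1 / 2) (τ i) (m i) := fun i => by
    have := Finset.single_le_sum (f := fun i => -logAffinity (1 / 2) (τ i) (m i))
      (fun i _ => neg_nonneg.2 (logAffinity_half_nonpos (hτ i) (m i))) (Finset.mem_univ i)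
    rw [Finset.sum_neg_distrib] at this
    linarith
  have hstep := fun i => logAffinity_one_add_le (hτ i) hl hl1 (hi i)
  have hres := integral_gaussianPdf_rpow (μA := μA) (μB := μB) (θ := 1 + l ^ 4 / 8)
    hA hB hL hτ h1 h2 fun i => (hstep i).1
  rw [show 1 - (1 + l ^ 4 / 8) = -(l ^ 4 / 8) by ring] at hres
  refine ⟨hres.1, hres.2.trans_le ?_⟩
  rw [← Real.le_log_iff_exp_le (by positivity), Real.log_inv, Real.log_pow]
  have := Finset.sum_le_sum fun i (_ : i ∈ Finset.univ) => (hstep i).2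
  rw [← Finset.mul_sum] at this
  push_cast
  linarith

theorem min_le_mul_min_add {a b c K s : ℝ} (ha : 0 < a) (hb : 0 < b) (hc : 0 < c) (hK : 1 ≤ K)
    (hs : 0 < s) :
    min b c ≤ K * min a c + K ^ (-s) * (a ^ (-s) * b ^ (1 + s)) := by
  have hK0 : 0 < K := by linarith
  rcases le_or_gt b (K * a) with h | h
  · have h1 : min b c ≤ K * min a c := by
      rw [mul_min_of_nonneg _ _ hK0.le]
      exact min_le_min h (le_mul_of_one_le_left hc.le hK)
    have : 0 ≤ K ^ (-s) * (a ^ (-s) * b ^ (1 + s)) := by positivity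
    linarith
  · have h1 : b ≤ K ^ (-s) * (a ^ (-s) * b ^ (1 + s)) := by
      rw [Real.rpow_add hb, Real.rpow_one, Real.rpow_neg hK0.le, Real.rpow_neg ha.le]
      have h2 : (K * a) ^ s ≤ b ^ s := Real.rpow_le_rpow (by positivity) h.le hs.le
      rw [Real.mul_rpow hK0.le ha.le] at h2
      have h3 : 0 < K ^ s := by positivity
      have h4 : 0 < a ^ s := by positivity
      field_simp
      exact h2
    have h2 : 0 ≤ K * min a c := mul_nonneg hK0.le (le_min ha.le hc.le)
    linarith [min_le_left b c]

theorem rpow_bound {ε s M : ℝ} (hε : 0 < ε) (hs : 0 < s) (hs1 : s ≤ 1) (hM : 0 ≤ M)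
    (h : ε ≤ (1 + M) ^ (-(4 / s))) :
    (ε ^ (-(1 / 2) : ℝ)) * ε + (ε ^ (-(1 / 2) : ℝ)) ^ (-s) * M ≤ ε ^ (s / 4) := by
  have hε1 : ε ≤ 1 := h.trans (Real.rpow_le_one_of_one_le_of_nonpos (by linarith)
    (by rw [neg_nonpos]; positivity))
  have h1 : ε ^ (-(1 / 2) : ℝ) * ε = ε ^ (1 / 2 : ℝ) := by
    nth_rewrite 2 [← Real.rpow_one ε]
    rw [← Real.rpow_add hε]; norm_num
  have h2 : (ε ^ (-(1 / 2) : ℝ)) ^ (-s) = ε ^ (s / 2) := by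
    rw [← Real.rpow_mul hε.le]; ring_nf
  have h3 : ε ^ (1 / 2 : ℝ) ≤ ε ^ (s / 2) := Real.rpow_le_rpow_of_exponent_ge hε hε1 (by linarith)
  have h4 : ε ^ (s / 4) * (1 + M) ≤ 1 := by
    have : ε ^ (s / 4) ≤ (1 + M)⁻¹ := by
      refine (Real.rpow_le_rpow hε.le h (by positivity)).trans_eq ?_
      rw [← Real.rpow_mul (by positivity), ← Real.rpow_neg_one]
      congr 1
      field_simp
    calc _ ≤ (1 + M)⁻¹ * (1 + M) := by gcongr
      _ = 1 := inv_mul_cancel₀ (by positivity)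
  have h5 : ε ^ (s / 2) = ε ^ (s / 4) * ε ^ (s / 4) := by
    rw [← Real.rpow_add hε]; ring_nf
  have h6 : 0 < ε ^ (s / 4) := by positivity
  rw [h1, h2]
  nlinarith

/-- If `A, B, C` are nondegenerate Gaussians on `ℝ^d` with `d_TV(A,B) ≤ 1 - λ` and
`d_TV(A,C) ≥ 1 - ε`, then `d_TV(B,C) ≥ 1 - ε^{c(λ)}` for some exponent `c(λ) > 0`
depending only on `λ` (not on `d`), provided `ε` is sufficiently small in terms of `λ`. -/
theorem stmt14 (lam : ℝ) (hlam : 0 < lam) :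
    ∃ c : ℝ, 0 < c ∧ ∃ ε₀ : ℝ, 0 < ε₀ ∧
      ∀ (d : ℕ) (μA μB μC : Fin d → ℝ) (SA SB SC : Matrix (Fin d) (Fin d) ℝ),
        SA.PosDef → SB.PosDef → SC.PosDef →
        ∀ ε : ℝ, 0 < ε → ε ≤ ε₀ →
        tvDist (gaussianMeasure d μA SA) (gaussianMeasure d μB SB) ≤ 1 - lam →
        1 - ε ≤ tvDist (gaussianMeasure d μA SA) (gaussianMeasure d μC SC) →
        1 - Real.rpow ε c ≤
          tvDist (gaussianMeasure d μB SB) (gaussianMeasure d μC SC) := by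

  set l := min lam 1 with hl_def
  have hl : 0 < l := lt_min hlam one_pos
  have hl1 : l ≤ 1 := min_le_right _ _
  have hl4 : l ^ 4 ≤ 1 := pow_le_one₀ hl.le hl1
  set s := l ^ 4 / 8 with hs_def
  have hs : 0 < s := by positivity
  refine ⟨s / 4, by positivity, (1 + (l ^ 5)⁻¹) ^ (-(4 / s)), by positivity, ?_⟩
  intro d μA μB μC SA SB SC hA hB hC ε hε hε0 hAB hAC
  rw [tvDist_gaussianMeasure hA hB] at hAB
  rw [tvDist_gaussianMeasure hA hC] at hAC
  rw [tvDist_gaussianMeasure hB hC]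
  obtain ⟨hint, hle⟩ := integral_gaussianPdf_rpow_le hA hB hl hl1
    (show l ≤ ∫ x, min (gaussianPdf d μA SA x) (gaussianPdf d μB SB x) by
      linarith [min_le_left lam 1])
  have hε1 : ε ≤ 1 := hε0.trans (Real.rpow_le_one_of_one_le_of_nonpos
    (le_add_of_nonneg_right (by positivity)) (by rw [neg_nonpos]; positivity))
  have hK : 1 ≤ ε ^ (-(1 / 2) : ℝ) :=
    Real.one_le_rpow_of_pos_of_le_one_of_nonpos hε hε1 (by norm_num)
  have hminAC : Integrable fun x => min (gaussianPdf d μA SA x) (gaussianPdf d μC SC x) :=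
    (integral_gaussianPdf hA μA).1.inf (integral_gaussianPdf hC μC).1
  have hminBC : Integrable fun x => min (gaussianPdf d μB SB x) (gaussianPdf d μC SC x) :=
    (integral_gaussianPdf hB μB).1.inf (integral_gaussianPdf hC μC).1
  set K := ε ^ (-(1 / 2) : ℝ) with hK_def
  rw [← hs_def] at hint hle
  have key : ∫ x, min (gaussianPdf d μB SB x) (gaussianPdf d μC SC x) ≤
      K * (∫ x, min (gaussianPdf d μA SA x) (gaussianPdf d μC SC x)) +
      K ^ (-s) * ∫ x, gaussianPdf d μA SA x ^ (-s) * gaussianPdf d μB SB x ^ (1 + s) := by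
    rw [← integral_const_mul, ← integral_const_mul,
      ← integral_add (hminAC.const_mul K) (hint.const_mul _)]
    exact integral_mono hminBC ((hminAC.const_mul K).add (hint.const_mul _)) fun x =>
      min_le_mul_min_add (gaussianPdf_pos hA _ x) (gaussianPdf_pos hB _ x)
        (gaussianPdf_pos hC _ x) hK hs
  have hfin := rpow_bound hε hs (by linarith) (by positivity) hε0
  have h1 : K * (∫ x, min (gaussianPdf d μA SA x) (gaussianPdf d μC SC x)) ≤ K * ε := by
    gcongr
    linarith
  have h2 : K ^ (-s) * ∫ x, gaussianPdf d μA SA x ^ (-s) * gaussianPdf d μB SB x ^ (1 + s) ≤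
      K ^ (-s) * (l ^ 5)⁻¹ := by
    gcongr
  rw [Real.rpow_eq_pow]
  linarith
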